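/- arXiv:1212.6089 — 12 statements merged into one kernel-verified Lean document; each statement's English description precedes it below -/
import Mathlib

section
/- For every x = (x₁,x₂) ∈ ℝ², the weighted rectilinear minimax objective satisfies the identity max_{1≤i≤m}(w_i + |r_{1i} − x₁| + |r_{2i} − x₂|) = max(a − x₁ + x₂, b + x₁ − x₂, c − x₁ − x₂, d + x₁ + x₂). -/
/-- For every `x = (x₁, x₂) ∈ ℝ²`, the weighted rectilinear minimax objective
`max_{1≤i≤m} (wᵢ + |r₁ᵢ - x₁| + |r₂ᵢ - x₂|)` equals
`max (a - x₁ + x₂, b + x₁ - x₂, c - x₁ - x₂, d + x₁ + x₂)`, where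
`a = max (wᵢ + r₁ᵢ - r₂ᵢ)`, `b = max (wᵢ - r₁ᵢ + r₂ᵢ)`,
`c = max (wᵢ + r₁ᵢ + r₂ᵢ)`, `d = max (wᵢ - r₁ᵢ - r₂ᵢ)`. -/
theorem stmt0 {m : ℕ} (hm : 1 ≤ m) (r1 r2 w : Fin m → ℝ)
    (hne : (Finset.univ : Finset (Fin m)).Nonempty) (x1 x2 : ℝ) :
    Finset.univ.sup' hne (fun i => w i + |r1 i - x1| + |r2 i - x2|) =
      max (max ((Finset.univ.sup' hne fun i => w i + r1 i - r2 i) - x1 + x2)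
               ((Finset.univ.sup' hne fun i => w i - r1 i + r2 i) + x1 - x2))
          (max ((Finset.univ.sup' hne fun i => w i + r1 i + r2 i) - x1 - x2)
               ((Finset.univ.sup' hne fun i => w i - r1 i - r2 i) + x1 + x2)) := by
  have up : ∀ (f : Fin m → ℝ) (i : Fin m), f i ≤ Finset.univ.sup' hne f :=
    fun f i => Finset.le_sup' f (Finset.mem_univ i)
  have att : ∀ f : Fin m → ℝ, ∃ i, Finset.univ.sup' hne f = f i := fun f => by
    obtain ⟨i, _, hi⟩ := Finset.exists_mem_eq_sup' hne f
    exact ⟨i, hi⟩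
  apply le_antisymm
  · apply Finset.sup'_le
    intro i _
    have ha := up (fun i => w i + r1 i - r2 i) i
    have hb := up (fun i => w i - r1 i + r2 i) i
    have hc := up (fun i => w i + r1 i + r2 i) i
    have hd := up (fun i => w i - r1 i - r2 i) i
    simp only [le_max_iff]
    rcases abs_cases (r1 i - x1) with ⟨h1, _⟩ | ⟨h1, _⟩ <;>
      rcases abs_cases (r2 i - x2) with ⟨h2, _⟩ | ⟨h2, _⟩ <;> rw [h1, h2]
    · right; left; linarith
    · left; left; linarith
    · left; right; linarith
    · right; right; linarith
  · have key : ∀ i, w i + |r1 i - x1| + |r2 i - x2| ≤ _ :=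
      up (fun i => w i + |r1 i - x1| + |r2 i - x2|)
    refine max_le (max_le ?_ ?_) (max_le ?_ ?_)
    · obtain ⟨i, hi⟩ := att (fun i => w i + r1 i - r2 i)
      rw [hi]
      linarith [key i, le_abs_self (r1 i - x1), neg_le_abs (r2 i - x2)]
    · obtain ⟨i, hi⟩ := att (fun i => w i - r1 i + r2 i)
      rw [hi]
      linarith [key i, neg_le_abs (r1 i - x1), le_abs_self (r2 i - x2)]
    · obtain ⟨i, hi⟩ := att (fun i => w i + r1 i + r2 i)
      rw [hi]
      linarith [key i, le_abs_self (r1 i - x1), le_abs_self (r2 i - x2)]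
    · obtain ⟨i, hi⟩ := att (fun i => w i - r1 i - r2 i)
      rw [hi]
      linarith [key i, neg_le_abs (r1 i - x1), neg_le_abs (r2 i - x2)]
end

section
/- For all real numbers a, b, c, d and every α ∈ [0,1], setting λ = max(a+b, c+d)/2, x₁(α) = (α/2)(a − d) − ((1−α)/2)(b − c) and x₂(α) = (2α−1)λ − (α/2)(a + d) + ((1−α)/2)(b + c), one has g(x₁(α), x₂(α)) = λ. -/
/-- For all reals `a b c d` and `α ∈ [0, 1]`, with
`λ = max (a + b, c + d) / 2`,
`x₁(α) = (α/2)(a - d) - ((1-α)/2)(b - c)` and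
`x₂(α) = (2α - 1)λ - (α/2)(a + d) + ((1-α)/2)(b + c)`,
one has `g (x₁(α), x₂(α)) = λ`. -/
theorem stmt2 (a b c d : ℝ) (α : ℝ) (hα : α ∈ Set.Icc (0 : ℝ) 1) :
    let lam := max (a + b) (c + d) / 2
    let x1 := α / 2 * (a - d) - (1 - α) / 2 * (b - c)
    let x2 := (2 * α - 1) * lam - α / 2 * (a + d) + (1 - α) / 2 * (b + c)
    max (max (a - x1 + x2) (b + x1 - x2)) (max (c - x1 - x2) (d + x1 + x2)) = lam := by
  obtain ⟨h0, h1⟩ := hα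
  intro lam x1 x2
  have hab : a + b ≤ 2 * lam := by
    have := le_max_left (a + b) (c + d)
    simp only [lam]; linarith
  have hcd : c + d ≤ 2 * lam := by
    have := le_max_right (a + b) (c + d)
    simp only [lam]; linarith
  have hor : a + b = 2 * lam ∨ c + d = 2 * lam := by
    rcases max_choice (a + b) (c + d) with h | h
    · left; simp only [lam]; linarith
    · right; simp only [lam]; linarith
  have e1 : a - x1 + x2 = lam - (1 - α) * (2 * lam - (a + b)) := by
    simp only [x1, x2]; ring
  have e2 : b + x1 - x2 = lam - α * (2 * lam - (a + b)) := by
    simp only [x1, x2]; ring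
  have e3 : c - x1 - x2 = lam - α * (2 * lam - (c + d)) := by
    simp only [x1, x2]; ring
  have e4 : d + x1 + x2 = lam - (1 - α) * (2 * lam - (c + d)) := by
    simp only [x1, x2]; ring
  rw [e1, e2, e3, e4]
  clear_value x1 x2 lam
  have hα' : 0 ≤ 1 - α := by linarith
  have p1 := mul_nonneg hα' (sub_nonneg.2 hab)
  have p2 := mul_nonneg h0 (sub_nonneg.2 hab)
  have p3 := mul_nonneg h0 (sub_nonneg.2 hcd)
  have p4 := mul_nonneg hα' (sub_nonneg.2 hcd)
  apply le_antisymm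
  · refine max_le (max_le ?_ ?_) (max_le ?_ ?_) <;> linarith
  · rcases hor with h | h
    · refine le_max_of_le_left (le_max_of_le_left ?_)
      rw [h]; simp
    · refine le_max_of_le_right (le_max_of_le_left ?_)
      rw [h]; simp
end

section
/- For all real numbers a, b, c, d, the number λ = max(a + b, c + d)/2 is the least element of the set {g(x₁,x₂) : (x₁,x₂) ∈ ℝ²}; that is, the unconstrained minimum of g over ℝ² exists and equals λ. -/
/-- For all reals `a b c d`, the number `λ = max (a + b, c + d) / 2` is the
least element of `{g (x₁, x₂) : (x₁, x₂) ∈ ℝ²}`, where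
`g (x₁, x₂) = max (a - x₁ + x₂, b + x₁ - x₂, c - x₁ - x₂, d + x₁ + x₂)`;
that is, the unconstrained minimum of `g` over `ℝ²` exists and equals `λ`. -/
theorem stmt3 (a b c d : ℝ) :
    IsLeast (Set.range fun x : ℝ × ℝ =>
        max (max (a - x.1 + x.2) (b + x.1 - x.2)) (max (c - x.1 - x.2) (d + x.1 + x.2)))
      (max (a + b) (c + d) / 2) := by
  constructor
  · refine ⟨((a - b + c - d) / 4, (c - d - a + b) / 4), ?_⟩
    have h1 : a - (a - b + c - d) / 4 + (c - d - a + b) / 4 = (a + b) / 2 := by ring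
    have h2 : b + (a - b + c - d) / 4 - (c - d - a + b) / 4 = (a + b) / 2 := by ring
    have h3 : c - (a - b + c - d) / 4 - (c - d - a + b) / 4 = (c + d) / 2 := by ring
    have h4 : d + (a - b + c - d) / 4 + (c - d - a + b) / 4 = (c + d) / 2 := by ring
    simp only [h1, h2, h3, h4, max_self]
    exact max_div_div_right (by norm_num) _ _
  · rintro _ ⟨⟨x, y⟩, rfl⟩
    simp only
    have h1 := le_max_left (a - x + y) (b + x - y)
    have h2 := le_max_right (a - x + y) (b + x - y)
    have h3 := le_max_left (c - x - y) (d + x + y)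
    have h4 := le_max_right (c - x - y) (d + x + y)
    have h5 := le_max_left (max (a - x + y) (b + x - y)) (max (c - x - y) (d + x + y))
    have h6 := le_max_right (max (a - x + y) (b + x - y)) (max (c - x - y) (d + x + y))
    rw [div_le_iff₀ (by norm_num)]
    apply max_le <;> linarith
end

section
/- The minimum over x = (x₁,x₂) ∈ ℝ² of max_{1≤i≤m}(w_i + |r_{1i} − x₁| + |r_{2i} − x₂|) exists and equals λ = max(a + b, c + d)/2, and for every α ∈ [0,1] it is attained at the point x(α) with coordinates x₁(α) = (α/2)(a − d) − ((1−α)/2)(b − c) and x₂(α) = (2α−1)λ − (α/2)(a + d) + ((1−α)/2)(b + c). -/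
/-- The minimum over `(x₁, x₂) ∈ ℝ²` of
`φ (x₁, x₂) = max_{1≤i≤m} (wᵢ + |r₁ᵢ - x₁| + |r₂ᵢ - x₂|)` exists and equals
`λ = max (a + b, c + d) / 2`, and for every `α ∈ [0, 1]` it is attained at the point with
coordinates `x₁(α) = (α/2)(a - d) - ((1-α)/2)(b - c)` and
`x₂(α) = (2α - 1)λ - (α/2)(a + d) + ((1-α)/2)(b + c)`. -/
theorem stmt4 {m : ℕ} (hm : 1 ≤ m) (r1 r2 w : Fin m → ℝ)
    (hne : (Finset.univ : Finset (Fin m)).Nonempty) :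
    let a := Finset.univ.sup' hne fun i => w i + r1 i - r2 i
    let b := Finset.univ.sup' hne fun i => w i - r1 i + r2 i
    let c := Finset.univ.sup' hne fun i => w i + r1 i + r2 i
    let d := Finset.univ.sup' hne fun i => w i - r1 i - r2 i
    let lam := max (a + b) (c + d) / 2
    let φ := fun x : ℝ × ℝ =>
      Finset.univ.sup' hne fun i => w i + |r1 i - x.1| + |r2 i - x.2|
    IsLeast (Set.range φ) lam ∧
      ∀ α ∈ Set.Icc (0 : ℝ) 1,
        φ (α / 2 * (a - d) - (1 - α) / 2 * (b - c),
           (2 * α - 1) * lam - α / 2 * (a + d) + (1 - α) / 2 * (b + c)) = lam := by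
  intro a b c d lam φ
  have hlow : ∀ x, lam ≤ φ x := by
    intro x
    have hφ : ∀ i, w i + |r1 i - x.1| + |r2 i - x.2| ≤ φ x := fun i =>
      Finset.le_sup' (fun i => w i + |r1 i - x.1| + |r2 i - x.2|) (Finset.mem_univ i)
    have h1 : a ≤ φ x + x.1 - x.2 := Finset.sup'_le _ _ fun i _ => by
      linarith [hφ i, le_abs_self (r1 i - x.1), neg_abs_le (r2 i - x.2)]
    have h2 : b ≤ φ x - x.1 + x.2 := Finset.sup'_le _ _ fun i _ => by
      linarith [hφ i, neg_abs_le (r1 i - x.1), le_abs_self (r2 i - x.2)]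
    have h3 : c ≤ φ x + x.1 + x.2 := Finset.sup'_le _ _ fun i _ => by
      linarith [hφ i, le_abs_self (r1 i - x.1), le_abs_self (r2 i - x.2)]
    have h4 : d ≤ φ x - x.1 - x.2 := Finset.sup'_le _ _ fun i _ => by
      linarith [hφ i, neg_abs_le (r1 i - x.1), neg_abs_le (r2 i - x.2)]
    have h5 : max (a + b) (c + d) ≤ 2 * φ x := max_le (by linarith) (by linarith)
    change max (a + b) (c + d) / 2 ≤ φ x
    linarith
  have hatt : ∀ α ∈ Set.Icc (0 : ℝ) 1,
        φ (α / 2 * (a - d) - (1 - α) / 2 * (b - c),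
           (2 * α - 1) * lam - α / 2 * (a + d) + (1 - α) / 2 * (b + c)) = lam := by
    rintro α ⟨h0, h1⟩
    refine le_antisymm ?_ (hlow _)
    have hl : lam = max (a + b) (c + d) / 2 := rfl
    have e1 : 0 ≤ 2 * lam - (a + b) := by linarith [le_max_left (a + b) (c + d)]
    have e2 : 0 ≤ 2 * lam - (c + d) := by linarith [le_max_right (a + b) (c + d)]
    have p1 := mul_nonneg h0 e1
    have p2 := mul_nonneg h0 e2
    have p3 := mul_nonneg (sub_nonneg.2 h1) e1
    have p4 := mul_nonneg (sub_nonneg.2 h1) e2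
    refine Finset.sup'_le _ _ fun i _ => ?_
    have ha : w i + r1 i - r2 i ≤ a :=
      Finset.le_sup' (fun i => w i + r1 i - r2 i) (Finset.mem_univ i)
    have hb : w i - r1 i + r2 i ≤ b :=
      Finset.le_sup' (fun i => w i - r1 i + r2 i) (Finset.mem_univ i)
    have hc : w i + r1 i + r2 i ≤ c :=
      Finset.le_sup' (fun i => w i + r1 i + r2 i) (Finset.mem_univ i)
    have hd : w i - r1 i - r2 i ≤ d :=
      Finset.le_sup' (fun i => w i - r1 i - r2 i) (Finset.mem_univ i)
    clear_value a b c d lam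
    dsimp only
    rcases abs_cases (r1 i - (α / 2 * (a - d) - (1 - α) / 2 * (b - c))) with ⟨h, -⟩ | ⟨h, -⟩ <;>
    rcases abs_cases (r2 i - ((2 * α - 1) * lam - α / 2 * (a + d) + (1 - α) / 2 * (b + c)))
      with ⟨h', -⟩ | ⟨h', -⟩ <;>
    rw [h, h'] <;> linarith
  refine ⟨⟨⟨_, hatt 0 (by simp)⟩, ?_⟩, hatt⟩
  rintro _ ⟨x, rfl⟩
  exact hlow x
end

section
/- If a + b ≥ c + d, then with λ = (a + b)/2 and, for α ∈ [0,1], x₁ = (α·a + (α−1)·b + (1−α)·c − α·d)/2 and x₂ = ((α−1)·a + α·b + (1−α)·c − α·d)/2, one has g(x₁, x₂) = λ. -/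
/-- If `a + b ≥ c + d`, then with `λ = (a + b) / 2` and, for `α ∈ [0, 1]`,
`x₁ = (α·a + (α-1)·b + (1-α)·c - α·d) / 2` and `x₂ = ((α-1)·a + α·b + (1-α)·c - α·d) / 2`,
one has `g (x₁, x₂) = λ`. -/
theorem stmt5 (a b c d : ℝ) (h : a + b ≥ c + d) (α : ℝ) (hα : α ∈ Set.Icc (0 : ℝ) 1) :
    let lam := (a + b) / 2
    let x1 := (α * a + (α - 1) * b + (1 - α) * c - α * d) / 2
    let x2 := ((α - 1) * a + α * b + (1 - α) * c - α * d) / 2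
    max (max (a - x1 + x2) (b + x1 - x2)) (max (c - x1 - x2) (d + x1 + x2)) = lam := by
  intro lam x1 x2
  obtain ⟨h0, h1⟩ := hα
  have e1 : a - x1 + x2 = lam := by simp only [x1, x2, lam]; ring
  have e2 : b + x1 - x2 = lam := by simp only [x1, x2, lam]; ring
  have e3 : c - x1 - x2 ≤ lam := by
    have := mul_nonneg h0 (sub_nonneg.2 h)
    simp only [x1, x2, lam]; linarith
  have e4 : d + x1 + x2 ≤ lam := by
    have := mul_nonneg (sub_nonneg.2 h1) (sub_nonneg.2 h)
    simp only [x1, x2, lam]; linarith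
  rw [e1, e2, max_self]
  exact max_eq_left (max_le e3 e4)
end

section
/- If c + d ≥ a + b, then with λ = (c + d)/2 and, for α ∈ [0,1], x₁ = (α·a + (α−1)·b + (1−α)·c − α·d)/2 and x₂ = (−α·a + (1−α)·b + α·c + (α−1)·d)/2, one has g(x₁, x₂) = λ. -/
/-- If `c + d ≥ a + b`, then with `λ = (c + d) / 2` and, for `α ∈ [0, 1]`,
`x₁ = (α·a + (α-1)·b + (1-α)·c - α·d) / 2` and `x₂ = (-α·a + (1-α)·b + α·c + (α-1)·d) / 2`,
one has `g (x₁, x₂) = λ`. -/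
theorem stmt6 (a b c d : ℝ) (h : c + d ≥ a + b) (α : ℝ) (hα : α ∈ Set.Icc (0 : ℝ) 1) :
    let lam := (c + d) / 2
    let x1 := (α * a + (α - 1) * b + (1 - α) * c - α * d) / 2
    let x2 := (-α * a + (1 - α) * b + α * c + (α - 1) * d) / 2
    max (max (a - x1 + x2) (b + x1 - x2)) (max (c - x1 - x2) (d + x1 + x2)) = lam := by
  intro lam x1 x2
  obtain ⟨h0, h1⟩ := hα
  have e3 : c - x1 - x2 = lam := by simp only [x1, x2, lam]; ring
  have e4 : d + x1 + x2 = lam := by simp only [x1, x2, lam]; ring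
  have e1 : a - x1 + x2 = lam - (1 - α) * (c + d - (a + b)) := by
    simp only [x1, x2, lam]; ring
  have e2 : b + x1 - x2 = lam - α * (c + d - (a + b)) := by
    simp only [x1, x2, lam]; ring
  have p1 : 0 ≤ (1 - α) * (c + d - (a + b)) := mul_nonneg (by linarith) (by linarith)
  have p2 : 0 ≤ α * (c + d - (a + b)) := mul_nonneg h0 (by linarith)
  rw [e3, e4, max_self]
  exact max_eq_right (max_le (by linarith) (by linarith))
end

section
/- For all real numbers a, b, c, d, the number λ = max(a + b, c + d)/2 is the least element of the set {max(a − y₁ + y₂, b + y₁ − y₂, c − y₂ + y₃, d + y₂ − y₃) : (y₁,y₂,y₃) ∈ ℝ³}; that is, the minimum over y ∈ ℝ³ of this four-term maximum exists and equals λ. -/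
/-- For all reals `a b c d`, the number `λ = max (a + b, c + d) / 2` is the
least element of `{max (a - y₁ + y₂, b + y₁ - y₂, c - y₂ + y₃, d + y₂ - y₃) : (y₁,y₂,y₃) ∈ ℝ³}`;
that is, the minimum over `y ∈ ℝ³` of this four-term maximum exists and equals `λ`. -/
theorem stmt7 (a b c d : ℝ) :
    IsLeast (Set.range fun y : ℝ × ℝ × ℝ =>
        max (max (a - y.1 + y.2.1) (b + y.1 - y.2.1))
            (max (c - y.2.1 + y.2.2) (d + y.2.1 - y.2.2)))
      (max (a + b) (c + d) / 2) := by
  constructor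
  · refine ⟨((a - b) / 2, 0, (d - c) / 2), ?_⟩
    have h1 : a - (a - b) / 2 + 0 = (a + b) / 2 := by ring
    have h2 : b + (a - b) / 2 - 0 = (a + b) / 2 := by ring
    have h3 : c - 0 + (d - c) / 2 = (c + d) / 2 := by ring
    have h4 : d + 0 - (d - c) / 2 = (c + d) / 2 := by ring
    simp only [h1, h2, h3, h4, max_self]
    exact max_div_div_right (by norm_num) _ _
  · rintro _ ⟨⟨x, y, z⟩, rfl⟩
    dsimp only
    generalize hM : max (max (a - x + y) (b + x - y)) (max (c - y + z) (d + y - z)) = M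
    have h := hM.le
    simp only [max_le_iff] at h
    obtain ⟨⟨h1, h2⟩, h3, h4⟩ := h
    have h5 : max (a + b) (c + d) ≤ 2 * M := max_le (by linarith) (by linarith)
    linarith
end

section
/- Let a, b, c, d ∈ ℝ, let λ = max(a + b, c + d)/2, and suppose u ∈ ℝ³ satisfies a + u₂ = λ + u₁, max(b + u₁, c + u₃) = λ + u₂, d + u₂ = λ + u₃, and v ∈ ℝ³ satisfies b + v₂ = λ + v₁, max(a + v₁, d + v₃) = λ + v₂, c + v₂ = λ + v₃. Then for every α ∈ [0,1], the vector y with components yᵢ = α·uᵢ − (1−α)·vᵢ satisfies max(a − y₁ + y₂, b + y₁ − y₂, c − y₂ + y₃, d + y₂ − y₃) = λ. -/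
/-- With `λ = max (a + b, c + d) / 2`, if `u ∈ ℝ³` is a max-plus eigenvector of
`A = [[-∞, a, -∞], [b, -∞, c], [-∞, d, -∞]]` with eigenvalue `λ` and `v ∈ ℝ³` is a max-plus
eigenvector of `Aᵀ` with eigenvalue `λ`, then for every `α ∈ [0, 1]` the vector `y` with
components `yᵢ = α·uᵢ - (1-α)·vᵢ` satisfies
`max (a - y₁ + y₂, b + y₁ - y₂, c - y₂ + y₃, d + y₂ - y₃) = λ`. -/
theorem stmt11 (a b c d : ℝ) (lam : ℝ) (hlam : lam = max (a + b) (c + d) / 2)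
    (u1 u2 u3 v1 v2 v3 : ℝ)
    (hu1 : a + u2 = lam + u1)
    (hu2 : max (b + u1) (c + u3) = lam + u2)
    (hu3 : d + u2 = lam + u3)
    (hv1 : b + v2 = lam + v1)
    (hv2 : max (a + v1) (d + v3) = lam + v2)
    (hv3 : c + v2 = lam + v3)
    (α : ℝ) (hα : α ∈ Set.Icc (0 : ℝ) 1) :
    let y1 := α * u1 - (1 - α) * v1
    let y2 := α * u2 - (1 - α) * v2
    let y3 := α * u3 - (1 - α) * v3
    max (max (a - y1 + y2) (b + y1 - y2)) (max (c - y2 + y3) (d + y2 - y3)) = lam := by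
  intro y1 y2 y3
  obtain ⟨h0, h1⟩ := hα
  have e1 : u1 = a + u2 - lam := by linarith
  have e3 : u3 = d + u2 - lam := by linarith
  have f1 : v1 = b + v2 - lam := by linarith
  have f3 : v3 = c + v2 - lam := by linarith
  have g1 : a - y1 + y2 = lam + (1 - α) * (a + b - 2 * lam) := by
    simp only [y1, y2, e1, f1]; ring
  have g2 : b + y1 - y2 = lam + α * (a + b - 2 * lam) := by
    simp only [y1, y2, e1, f1]; ring
  have g3 : c - y2 + y3 = lam + α * (c + d - 2 * lam) := by
    simp only [y3, y2, e3, f3]; ring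
  have g4 : d + y2 - y3 = lam + (1 - α) * (c + d - 2 * lam) := by
    simp only [y3, y2, e3, f3]; ring
  rw [g1, g2, g3, g4]
  have k1 : a + b - 2 * lam ≤ 0 := by linarith [le_max_left (a + b) (c + d)]
  have k2 : c + d - 2 * lam ≤ 0 := by linarith [le_max_right (a + b) (c + d)]
  have h1' : 0 ≤ 1 - α := by linarith
  have m1 := mul_nonpos_of_nonneg_of_nonpos h1' k1
  have m2 := mul_nonpos_of_nonneg_of_nonpos h0 k1
  have m3 := mul_nonpos_of_nonneg_of_nonpos h0 k2
  have m4 := mul_nonpos_of_nonneg_of_nonpos h1' k2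
  apply le_antisymm
  · refine max_le (max_le ?_ ?_) (max_le ?_ ?_) <;> linarith
  · rcases max_choice (a + b) (c + d) with h | h
    · have z : a + b - 2 * lam = 0 := by linarith
      refine le_trans ?_ (le_max_left _ _)
      simp [z]
    · have z : c + d - 2 * lam = 0 := by linarith
      refine le_trans ?_ (le_max_right _ _)
      simp [z]
end

section
/- Let n ≥ 1, let A be an n × n matrix with entries in ℝ ∪ {−∞}, let λ ∈ ℝ, and let u : {1,…,n} → ℝ satisfy the max-plus eigenvalue equation max_{1≤j≤n}(A_{ij} + u_j) = λ + u_i for every i (computed in ℝ ∪ {−∞}, where −∞ + t = −∞). Then for every x : {1,…,n} → ℝ, one has max_{1≤i,j≤n}(A_{ij} + x_j − x_i) ≥ λ (in ℝ ∪ {−∞}). -/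
/-- Let `n ≥ 1`, let `A` be an `n × n` matrix with entries in `ℝ ∪ {-∞}`
(modelled as `WithBot ℝ`, where `⊥ + t = ⊥`), let `λ ∈ ℝ`, and let `u : Fin n → ℝ` satisfy
the max-plus eigenvalue equation `max_j (A i j + u j) = λ + u i` for every `i`. Then for
every `x : Fin n → ℝ` one has `max_{i,j} (A i j + x j - x i) ≥ λ` in `ℝ ∪ {-∞}`. -/
theorem stmt12 {n : ℕ} (hn : 1 ≤ n) (A : Fin n → Fin n → WithBot ℝ) (lam : ℝ)
    (u : Fin n → ℝ)
    (hne : (Finset.univ : Finset (Fin n)).Nonempty)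
    (hp : (Finset.univ : Finset (Fin n × Fin n)).Nonempty)
    (hu : ∀ i, Finset.univ.sup' hne (fun j => A i j + (u j : WithBot ℝ)) =
      (lam : WithBot ℝ) + (u i : WithBot ℝ)) :
    ∀ x : Fin n → ℝ,
      (lam : WithBot ℝ) ≤
        Finset.univ.sup' hp (fun ij : Fin n × Fin n =>
          A ij.1 ij.2 + ((x ij.2 - x ij.1 : ℝ) : WithBot ℝ)) := by
  intro x
  obtain ⟨i, -, hi⟩ := Finset.exists_min_image Finset.univ (fun i => x i - u i) hne
  obtain ⟨j, -, hj⟩ := Finset.exists_mem_eq_sup' hne (fun j => A i j + (u j : WithBot ℝ))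
  rw [hu i] at hj
  have hij := hi j (Finset.mem_univ j)
  refine le_trans ?_ (Finset.le_sup' (fun ij : Fin n × Fin n =>
          A ij.1 ij.2 + ((x ij.2 - x ij.1 : ℝ) : WithBot ℝ)) (Finset.mem_univ (i, j)))
  show (lam : WithBot ℝ) ≤ A i j + ((x j - x i : ℝ) : WithBot ℝ)
  revert hj
  generalize A i j = a
  intro hj
  induction a using WithBot.recBotCoe with
  | bot =>
    rw [WithBot.bot_add, ← WithBot.coe_add] at hj
    exact absurd hj WithBot.coe_ne_bot
  | coe a =>
    rw [← WithBot.coe_add, ← WithBot.coe_add, WithBot.coe_inj] at hj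
    rw [← WithBot.coe_add, WithBot.coe_le_coe]
    linarith
end

section
/- Let n ≥ 1, let A be an n × n matrix with entries in ℝ ∪ {−∞}, let λ ∈ ℝ, and let u, v : {1,…,n} → ℝ satisfy max_{1≤j≤n}(A_{ij} + u_j) = λ + u_i and max_{1≤j≤n}(A_{ji} + v_j) = λ + v_i for every i (computed in ℝ ∪ {−∞}). Then for every α ∈ [0,1], the vector x with components x_i = α·u_i − (1−α)·v_i satisfies max_{1≤i,j≤n}(A_{ij} + x_j − x_i) ≤ λ, and hence, combined with the lower bound valid for all x, this x attains min_{x∈ℝⁿ} max_{1≤i,j≤n}(A_{ij} + x_j − x_i) = λ. -/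
/-- Let `n ≥ 1`, let `A` be an `n × n` matrix with entries in `ℝ ∪ {-∞}`
(modelled as `WithBot ℝ`), let `λ ∈ ℝ`, and let `u, v : Fin n → ℝ` be max-plus eigenvectors
of `A` and of its transpose, both with eigenvalue `λ`:
`max_j (A i j + u j) = λ + u i` and `max_j (A j i + v j) = λ + v i` for every `i`.
Then for every `α ∈ [0, 1]` the vector `x` with `x i = α·u i - (1-α)·v i` satisfies
`max_{i,j} (A i j + x j - x i) ≤ λ`, and hence, combined with the lower bound valid for all
`x`, this `x` attains `min_{x ∈ ℝⁿ} max_{i,j} (A i j + x j - x i) = λ`. -/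
theorem stmt13 {n : ℕ} (hn : 1 ≤ n) (A : Fin n → Fin n → WithBot ℝ) (lam : ℝ)
    (u v : Fin n → ℝ)
    (hne : (Finset.univ : Finset (Fin n)).Nonempty)
    (hp : (Finset.univ : Finset (Fin n × Fin n)).Nonempty)
    (hu : ∀ i, Finset.univ.sup' hne (fun j => A i j + (u j : WithBot ℝ)) =
      (lam : WithBot ℝ) + (u i : WithBot ℝ))
    (hv : ∀ i, Finset.univ.sup' hne (fun j => A j i + (v j : WithBot ℝ)) =
      (lam : WithBot ℝ) + (v i : WithBot ℝ))
    (α : ℝ) (hα : α ∈ Set.Icc (0 : ℝ) 1) :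
    let f := fun y : Fin n → ℝ =>
      Finset.univ.sup' hp (fun ij : Fin n × Fin n =>
        A ij.1 ij.2 + ((y ij.2 - y ij.1 : ℝ) : WithBot ℝ))
    let x := fun i => α * u i - (1 - α) * v i
    f x ≤ (lam : WithBot ℝ) ∧ IsLeast (Set.range f) (lam : WithBot ℝ) := by
  intro f x
  have hub : f x ≤ (lam : WithBot ℝ) := by
    refine Finset.sup'_le _ _ ?_
    rintro ⟨i, j⟩ -
    have h1 : A i j + (u j : WithBot ℝ) ≤ (lam : WithBot ℝ) + (u i : WithBot ℝ) :=
      (hu i) ▸ Finset.le_sup' (fun j => A i j + (u j : WithBot ℝ)) (Finset.mem_univ j)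
    have h2 : A i j + (v i : WithBot ℝ) ≤ (lam : WithBot ℝ) + (v j : WithBot ℝ) :=
      (hv j) ▸ Finset.le_sup' (fun k => A k j + (v k : WithBot ℝ)) (Finset.mem_univ i)
    show A i j + ((x j - x i : ℝ) : WithBot ℝ) ≤ (lam : WithBot ℝ)
    generalize A i j = a at h1 h2
    induction a using WithBot.recBotCoe with
    | bot => simp
    | coe a =>
      norm_cast at h1 h2 ⊢
      simp only [x]
      nlinarith [mul_le_mul_of_nonneg_left h1 hα.1,
        mul_le_mul_of_nonneg_left h2 (sub_nonneg.2 hα.2)]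
  have hlb : ∀ y, (lam : WithBot ℝ) ≤ f y := by
    intro y
    obtain ⟨i, -, hi⟩ := Finset.exists_min_image Finset.univ (fun i => y i - u i) hne
    obtain ⟨j, -, hj⟩ := Finset.exists_mem_eq_sup' hne (fun j => A i j + (u j : WithBot ℝ))
    rw [hu i] at hj
    have hij := hi j (Finset.mem_univ j)
    refine le_trans ?_ (Finset.le_sup' (fun ij : Fin n × Fin n =>
        A ij.1 ij.2 + ((y ij.2 - y ij.1 : ℝ) : WithBot ℝ)) (Finset.mem_univ (i, j)))
    show (lam : WithBot ℝ) ≤ A i j + ((y j - y i : ℝ) : WithBot ℝ)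
    generalize A i j = a at hj
    induction a using WithBot.recBotCoe with
    | bot =>
      rw [WithBot.bot_add, ← WithBot.coe_add] at hj
      exact absurd hj (WithBot.coe_ne_bot)
    | coe a =>
      norm_cast at hj ⊢
      linarith
  refine ⟨hub, ⟨x, le_antisymm hub (hlb x)⟩, ?_⟩
  rintro _ ⟨y, rfl⟩
  exact hlb y
end

section
/- The minimum over x = (x₁,x₂) ∈ ℝ² of ψ(x) = max( max_{1≤i≤m}(w_i + |r_{1i} − x₁| + |r_{2i} − x₂|) − λ₀, a₁ − x₁ + x₂, b₁ + x₁ − x₂, c₁ − x₁ − x₂, d₁ + x₁ + x₂ ) exists and equals λ = max(a + b, c + d)/2, where a = max(a₀ − λ₀, a₁), b = max(b₀ − λ₀, b₁), c = max(c₀ − λ₀, c₁), d = max(d₀ − λ₀, d₁); moreover for every α ∈ [0,1] it is attained at the point with coordinates x₁(α) = (α/2)(a − d) − ((1−α)/2)(b − c) and x₂(α) = (2α−1)λ − (α/2)(a + d) + ((1−α)/2)(b + c). -/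
/-- The minimum over `(x₁, x₂) ∈ ℝ²` of
`ψ x = max (max_{1≤i≤m} (wᵢ + |r₁ᵢ - x₁| + |r₂ᵢ - x₂|) - λ₀,
  a₁ - x₁ + x₂, b₁ + x₁ - x₂, c₁ - x₁ - x₂, d₁ + x₁ + x₂)`
exists and equals `λ = max (a + b, c + d) / 2`, where `a = max (a₀ - λ₀, a₁)`,
`b = max (b₀ - λ₀, b₁)`, `c = max (c₀ - λ₀, c₁)`, `d = max (d₀ - λ₀, d₁)`; moreover for
every `α ∈ [0, 1]` it is attained at `x₁(α) = (α/2)(a - d) - ((1-α)/2)(b - c)`,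
`x₂(α) = (2α - 1)λ - (α/2)(a + d) + ((1-α)/2)(b + c)`. -/
theorem stmt14 {m : ℕ} (hm : 1 ≤ m) (r1 r2 w : Fin m → ℝ)
    (hne : (Finset.univ : Finset (Fin m)).Nonempty)
    (a1 b1 c1 d1 : ℝ) :
    let a0 := Finset.univ.sup' hne fun i => w i + r1 i - r2 i
    let b0 := Finset.univ.sup' hne fun i => w i - r1 i + r2 i
    let c0 := Finset.univ.sup' hne fun i => w i + r1 i + r2 i
    let d0 := Finset.univ.sup' hne fun i => w i - r1 i - r2 i
    let lam0 := max (a0 + b0) (c0 + d0) / 2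
    let a := max (a0 - lam0) a1
    let b := max (b0 - lam0) b1
    let c := max (c0 - lam0) c1
    let d := max (d0 - lam0) d1
    let lam := max (a + b) (c + d) / 2
    let ψ := fun x : ℝ × ℝ =>
      max ((Finset.univ.sup' hne fun i => w i + |r1 i - x.1| + |r2 i - x.2|) - lam0)
        (max (max (a1 - x.1 + x.2) (b1 + x.1 - x.2)) (max (c1 - x.1 - x.2) (d1 + x.1 + x.2)))
    IsLeast (Set.range ψ) lam ∧
      ∀ α ∈ Set.Icc (0 : ℝ) 1,
        ψ (α / 2 * (a - d) - (1 - α) / 2 * (b - c),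
           (2 * α - 1) * lam - α / 2 * (a + d) + (1 - α) / 2 * (b + c)) = lam := by
  intro a0 b0 c0 d0 lam0 a b c d lam ψ
  have key : ∀ (x : ℝ × ℝ) (t : ℝ), ψ x ≤ t ↔
      (a - x.1 + x.2 ≤ t ∧ b + x.1 - x.2 ≤ t ∧ c - x.1 - x.2 ≤ t ∧ d + x.1 + x.2 ≤ t) := by
    intro x t
    have ha0 : ∀ s, a0 ≤ s ↔ ∀ i, w i + r1 i - r2 i ≤ s := fun s => by simp [a0]
    have hb0 : ∀ s, b0 ≤ s ↔ ∀ i, w i - r1 i + r2 i ≤ s := fun s => by simp [b0]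
    have hc0 : ∀ s, c0 ≤ s ↔ ∀ i, w i + r1 i + r2 i ≤ s := fun s => by simp [c0]
    have hd0 : ∀ s, d0 ≤ s ↔ ∀ i, w i - r1 i - r2 i ≤ s := fun s => by simp [d0]
    have hS : ∀ s, (Finset.univ.sup' hne fun i => w i + |r1 i - x.1| + |r2 i - x.2|) ≤ s ↔
        ∀ i, w i + |r1 i - x.1| + |r2 i - x.2| ≤ s := fun s => by simp
    simp only [ψ, max_le_iff]
    constructor
    · rintro ⟨h, ⟨h1, h2⟩, h3, h4⟩
      replace h := (hS _).1 (sub_le_iff_le_add.1 h)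
      have e1 : a0 ≤ t + lam0 + x.1 - x.2 := (ha0 _).2 fun i => by
        linarith [h i, le_abs_self (r1 i - x.1), neg_abs_le (r2 i - x.2)]
      have e2 : b0 ≤ t + lam0 - x.1 + x.2 := (hb0 _).2 fun i => by
        linarith [h i, neg_abs_le (r1 i - x.1), le_abs_self (r2 i - x.2)]
      have e3 : c0 ≤ t + lam0 + x.1 + x.2 := (hc0 _).2 fun i => by
        linarith [h i, le_abs_self (r1 i - x.1), le_abs_self (r2 i - x.2)]
      have e4 : d0 ≤ t + lam0 - x.1 - x.2 := (hd0 _).2 fun i => by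
        linarith [h i, neg_abs_le (r1 i - x.1), neg_abs_le (r2 i - x.2)]
      have f1 : a ≤ t + x.1 - x.2 := max_le (by linarith) (by linarith)
      have f2 : b ≤ t - x.1 + x.2 := max_le (by linarith) (by linarith)
      have f3 : c ≤ t + x.1 + x.2 := max_le (by linarith) (by linarith)
      have f4 : d ≤ t - x.1 - x.2 := max_le (by linarith) (by linarith)
      exact ⟨by linarith, by linarith, by linarith, by linarith⟩
    · rintro ⟨h1, h2, h3, h4⟩
      have p1 : a0 - lam0 ≤ a := le_max_left _ _
      have p2 : b0 - lam0 ≤ b := le_max_left _ _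
      have p3 : c0 - lam0 ≤ c := le_max_left _ _
      have p4 : d0 - lam0 ≤ d := le_max_left _ _
      have q1 : a1 ≤ a := le_max_right _ _
      have q2 : b1 ≤ b := le_max_right _ _
      have q3 : c1 ≤ c := le_max_right _ _
      have q4 : d1 ≤ d := le_max_right _ _
      refine ⟨sub_le_iff_le_add.2 ((hS _).2 fun i => ?_), ⟨by linarith, by linarith⟩, by linarith, by linarith⟩
      have g1 := (ha0 _).1 le_rfl i
      have g2 := (hb0 _).1 le_rfl i
      have g3 := (hc0 _).1 le_rfl i
      have g4 := (hd0 _).1 le_rfl i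
      rcases abs_cases (r1 i - x.1) with ⟨u, _⟩ | ⟨u, _⟩ <;>
        rcases abs_cases (r2 i - x.2) with ⟨v, _⟩ | ⟨v, _⟩ <;> rw [u, v] <;> linarith
  have low : ∀ x, lam ≤ ψ x := by
    intro x
    obtain ⟨h1, h2, h3, h4⟩ := (key x _).1 le_rfl
    have : max (a + b) (c + d) ≤ 2 * ψ x := max_le (by linarith) (by linarith)
    have hl : lam = max (a + b) (c + d) / 2 := rfl
    linarith
  have att : ∀ α ∈ Set.Icc (0 : ℝ) 1,
      ψ (α / 2 * (a - d) - (1 - α) / 2 * (b - c),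
         (2 * α - 1) * lam - α / 2 * (a + d) + (1 - α) / 2 * (b + c)) = lam := by
    rintro α ⟨h0, h1⟩
    refine le_antisymm ((key _ _).2 ?_) (low _)
    have hl : lam = max (a + b) (c + d) / 2 := rfl
    have hab : 0 ≤ 2 * lam - (a + b) := by linarith [le_max_left (a + b) (c + d)]
    have hcd : 0 ≤ 2 * lam - (c + d) := by linarith [le_max_right (a + b) (c + d)]
    clear_value lam a b c d
    have k1 := mul_nonneg h0 hab
    have k2 := mul_nonneg (sub_nonneg.2 h1) hab
    have k3 := mul_nonneg h0 hcd
    have k4 := mul_nonneg (sub_nonneg.2 h1) hcd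
    refine ⟨?_, ?_, ?_, ?_⟩ <;> dsimp only <;> linarith
  exact ⟨⟨⟨_, att 0 (by simp)⟩, by rintro _ ⟨x, rfl⟩; exact low x⟩, att⟩
end

section
/- With a = max(a₀ − λ₀, a₁), b = max(b₀ − λ₀, b₁), c = max(c₀ − λ₀, c₁), d = max(d₀ − λ₀, d₁), and λ = max(a + b, c + d)/2, one has λ = 0 if and only if there exists x = (x₁,x₂) ∈ ℝ² such that max(a₀ − x₁ + x₂, b₀ + x₁ − x₂, c₀ − x₁ − x₂, d₀ + x₁ + x₂) = λ₀ and simultaneously a₁ − x₁ + x₂ ≤ 0, b₁ + x₁ − x₂ ≤ 0, c₁ − x₁ − x₂ ≤ 0, d₁ + x₁ + x₂ ≤ 0; that is, λ = 0 exactly when the feasible set is nonempty and intersects the solution set of the unconstrained problem. -/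
/-- With `λ₀ = max (a₀ + b₀, c₀ + d₀) / 2`, `a = max (a₀ - λ₀, a₁)`,
`b = max (b₀ - λ₀, b₁)`, `c = max (c₀ - λ₀, c₁)`, `d = max (d₀ - λ₀, d₁)` and
`λ = max (a + b, c + d) / 2`, one has `λ = 0` if and only if there exists
`(x₁, x₂) ∈ ℝ²` with `max (a₀ - x₁ + x₂, b₀ + x₁ - x₂, c₀ - x₁ - x₂, d₀ + x₁ + x₂) = λ₀`
and `a₁ - x₁ + x₂ ≤ 0`, `b₁ + x₁ - x₂ ≤ 0`, `c₁ - x₁ - x₂ ≤ 0`, `d₁ + x₁ + x₂ ≤ 0`;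
that is, `λ = 0` exactly when the feasible set is nonempty and intersects the solution set
of the unconstrained problem. -/
theorem stmt16 (a0 b0 c0 d0 a1 b1 c1 d1 : ℝ) :
    let lam0 := max (a0 + b0) (c0 + d0) / 2
    let a := max (a0 - lam0) a1
    let b := max (b0 - lam0) b1
    let c := max (c0 - lam0) c1
    let d := max (d0 - lam0) d1
    let lam := max (a + b) (c + d) / 2
    (lam = 0 ↔ ∃ x1 x2 : ℝ,
      max (max (a0 - x1 + x2) (b0 + x1 - x2)) (max (c0 - x1 - x2) (d0 + x1 + x2)) = lam0 ∧
      a1 - x1 + x2 ≤ 0 ∧ b1 + x1 - x2 ≤ 0 ∧ c1 - x1 - x2 ≤ 0 ∧ d1 + x1 + x2 ≤ 0) := by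
  intro lam0 a b c d lam
  have h0 : a0 + b0 ≤ 2 * lam0 := by
    have := le_max_left (a0 + b0) (c0 + d0)
    simp only [lam0]; linarith
  have h0' : c0 + d0 ≤ 2 * lam0 := by
    have := le_max_right (a0 + b0) (c0 + d0)
    simp only [lam0]; linarith
  have h1 : 2 * lam0 = a0 + b0 ∨ 2 * lam0 = c0 + d0 := by
    rcases max_choice (a0 + b0) (c0 + d0) with h | h
    · left; simp only [lam0]; linarith
    · right; simp only [lam0]; linarith
  have ha : a0 - lam0 ≤ a := le_max_left _ _
  have ha' : a1 ≤ a := le_max_right _ _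
  have hb : b0 - lam0 ≤ b := le_max_left _ _
  have hb' : b1 ≤ b := le_max_right _ _
  have hc : c0 - lam0 ≤ c := le_max_left _ _
  have hc' : c1 ≤ c := le_max_right _ _
  have hd : d0 - lam0 ≤ d := le_max_left _ _
  have hd' : d1 ≤ d := le_max_right _ _
  have hl : a + b ≤ 2 * lam := by
    have := le_max_left (a + b) (c + d)
    simp only [lam]; linarith
  have hl' : c + d ≤ 2 * lam := by
    have := le_max_right (a + b) (c + d)
    simp only [lam]; linarith
  constructor
  · intro h
    refine ⟨(a + c) / 2, (c - a) / 2, le_antisymm ?_ ?_, ?_, ?_, ?_, ?_⟩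
    · refine max_le (max_le ?_ ?_) (max_le ?_ ?_) <;> linarith
    · by_contra hlt
      rw [not_le, max_lt_iff, max_lt_iff, max_lt_iff] at hlt
      obtain ⟨⟨_, _⟩, _, _⟩ := hlt
      rcases h1 with h1 | h1 <;> linarith
    all_goals linarith
  · rintro ⟨x1, x2, hm, k1, k2, k3, k4⟩
    have hm' := hm.le
    rw [max_le_iff, max_le_iff, max_le_iff] at hm'
    obtain ⟨⟨m1, m2⟩, m3, m4⟩ := hm'
    have ea : a ≤ x1 - x2 := max_le (by linarith) (by linarith)
    have eb : b ≤ x2 - x1 := max_le (by linarith) (by linarith)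
    have ec : c ≤ x1 + x2 := max_le (by linarith) (by linarith)
    have ed : d ≤ -x1 - x2 := max_le (by linarith) (by linarith)
    have e : max (a + b) (c + d) ≤ 0 := max_le (by linarith) (by linarith)
    have e' : lam ≤ 0 := by simp only [lam]; linarith
    refine le_antisymm e' ?_
    rcases h1 with h1 | h1 <;> linarith
end
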